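/- arXiv:1812.02017 — 2 statements merged into one kernel-verified Lean document; each statement's English description precedes it below -/
import Mathlib

section
/- Let a1, a2 ∈ (0,1), p2 > 0, d3 > 0, k > 0. The dimensionless three-compartment hematopoiesis model has a strictly positive steady state at which every complex eigenvalue of the Jacobian matrix has negative real part if and only if a1 > 1/2, a2 < a1, and p2 > (1/(1 − a2/a1))·(1/γ(a1,a2) − β(a1,a2)·d3). -/
open Polynomial Matrix

/-- A point is a steady state of the dimensionless three-compartment
hematopoiesis model iff all three right-hand sides vanish there. -/
def IsSteadyState (a1 a2 p2 d3 k x y z : ℝ) : Prop :=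
  (2 * a1 / (1 + k * z) - 1) * x = 0 ∧
  (2 * a2 / (1 + k * z) - 1) * p2 * y + 2 * (1 - a1 / (1 + k * z)) * x = 0 ∧
  2 * (1 - a2 / (1 + k * z)) * p2 * y - d3 * z = 0

/-- The Jacobian (derivative matrix) of the right-hand side of the
dimensionless three-compartment hematopoiesis model at the point `(x,y,z)`. -/
noncomputable def modelJacobian (a1 a2 p2 d3 k x y z : ℝ) : Matrix (Fin 3) (Fin 3) ℝ :=
  !![2 * a1 / (1 + k * z) - 1, 0,
       -(2 * a1 * k * (1 / (1 + k * z) ^ 2) * x);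
     2 * (1 - a1 / (1 + k * z)), (2 * a2 / (1 + k * z) - 1) * p2,
       -(2 * p2 * a2 * k * (1 / (1 + k * z) ^ 2) * y)
         + 2 * a1 * k * (1 / (1 + k * z) ^ 2) * x;
     0, 2 * (1 - a2 / (1 + k * z)) * p2,
       2 * p2 * a2 * k * (1 / (1 + k * z) ^ 2) * y - d3]

/-- Routh–Hurwitz for cubics with positive coefficients. -/
lemma routh_cubic (b2 b1 b0 : ℝ) (h2 : 0 < b2) (h1 : 0 < b1) (h0 : 0 < b0) :
    (∀ μ : ℂ, μ ^ 3 + b2 * μ ^ 2 + b1 * μ + b0 = 0 → μ.re < 0) ↔ b0 < b2 * b1 := by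
  constructor
  · intro h
    by_contra hcon
    push Not at hcon
    have hex : ∃ t : ℝ, t ≤ -b2 ∧ t ^ 3 + b2 * t ^ 2 + b1 * t + b0 = 0 := by
      have hc : ContinuousOn (fun t : ℝ => t ^ 3 + b2 * t ^ 2 + b1 * t + b0)
          (Set.Icc (-(1 + b2 + b1 + b0)) (-b2)) := by fun_prop
      have hle : -(1 + b2 + b1 + b0) ≤ -b2 := by linarith
      have hmem : (0 : ℝ) ∈ Set.Icc
          ((fun t : ℝ => t ^ 3 + b2 * t ^ 2 + b1 * t + b0) (-(1 + b2 + b1 + b0)))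
          ((fun t : ℝ => t ^ 3 + b2 * t ^ 2 + b1 * t + b0) (-b2)) := by
        constructor
        · show (-(1 + b2 + b1 + b0)) ^ 3 + b2 * (-(1 + b2 + b1 + b0)) ^ 2
            + b1 * (-(1 + b2 + b1 + b0)) + b0 ≤ 0
          have e : (-(1 + b2 + b1 + b0)) ^ 3 + b2 * (-(1 + b2 + b1 + b0)) ^ 2
            + b1 * (-(1 + b2 + b1 + b0)) + b0 =
            -((1 + b2 + b1 + b0) ^ 2 * (1 + b1 + b0) + b1 * (1 + b2 + b1 + b0) - b0) := by ring
          have : 0 ≤ (1 + b2 + b1 + b0) ^ 2 * (1 + b1 + b0) + b1 * (1 + b2 + b1 + b0) - b0 := by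
            ring_nf
            positivity
          linarith
        · show 0 ≤ (-b2) ^ 3 + b2 * (-b2) ^ 2 + b1 * (-b2) + b0
          nlinarith
      obtain ⟨t, ht, hft⟩ := intermediate_value_Icc hle hc hmem
      exact ⟨t, ht.2, hft⟩
    obtain ⟨t, ht, hft⟩ := hex
    obtain ⟨s, hs⟩ := IsAlgClosed.exists_pow_nat_eq
      (((b2 + t) ^ 2 - 4 * (b1 + t * (b2 + t)) : ℝ) : ℂ) (n := 2) (by norm_num)
    have hftC : (t : ℂ) ^ 3 + b2 * t ^ 2 + b1 * t + b0 = 0 := by exact_mod_cast hft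
    push_cast at hs
    have r1 := h ((-(b2 + t) + s) / 2) (by
      linear_combination hftC + ((-(b2 + t) + s) / 2 - t) / 4 * hs)
    have r2 := h ((-(b2 + t) - s) / 2) (by
      linear_combination hftC + ((-(b2 + t) - s) / 2 - t) / 4 * hs)
    have e : ((-(b2 + t) + s) / 2 : ℂ).re + ((-(b2 + t) - s) / 2 : ℂ).re = -(b2 + t) := by
      rw [← Complex.add_re]
      have : ((-(b2 + t) + s) / 2 + (-(b2 + t) - s) / 2 : ℂ) = ((-(b2 + t) : ℝ) : ℂ) := by
        push_cast; ring
      rw [this, Complex.ofReal_re]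
    linarith
  · intro h μ hμ
    by_contra hx
    push Not at hx
    have hre := congrArg Complex.re hμ
    have him := congrArg Complex.im hμ
    obtain ⟨x, y⟩ := μ
    simp [pow_succ] at hre him hx
    have hy : y * (3 * x ^ 2 - y ^ 2 + 2 * b2 * x + b1) = 0 := by linear_combination him
    rcases mul_eq_zero.mp hy with hy | hy
    · subst hy
      have : 0 < x ^ 3 + b2 * x ^ 2 + b1 * x + b0 := by positivity
      nlinarith
    · have e : 8 * x ^ 3 + 8 * b2 * x ^ 2 + 2 * (b2 ^ 2 + b1) * x + (b2 * b1 - b0) = 0 := by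
        linear_combination -hre + (3 * x + b2) * hy
      have : 0 ≤ 8 * x ^ 3 + 8 * b2 * x ^ 2 + 2 * (b2 ^ 2 + b1) * x := by positivity
      linarith

lemma charpoly_root (A B q g d : ℝ) (μ : ℂ) :
    ((!![0, 0, -A; 1, -q, A - B; 0, g, B - d] : Matrix (Fin 3) (Fin 3) ℝ).map
      Complex.ofReal).charpoly.IsRoot μ ↔
    μ ^ 3 + ((q + d - B : ℝ) : ℂ) * μ ^ 2 + ((q * (d - B) + g * (B - A) : ℝ) : ℂ) * μ
      + ((A * g : ℝ) : ℂ) = 0 := by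
  rw [Polynomial.IsRoot, Matrix.eval_charpoly, Matrix.det_fin_three]
  simp
  ring_nf

/-- stability criterion in terms of `r = a2/a1` and `c = 1 - 1/(2 a1)`. -/
lemma stab_iff (r c p d : ℝ) (hr0 : 0 < r) (hr : r < 1) (hc0 : 0 < c) (hc : c < 1)
    (hp : 0 < p) (hd : 0 < d) :
    (∀ μ : ℂ, ((!![0, 0, -((1 - r) * (d * c / (2 - r)));
        1, -((1 - r) * p), (1 - r) * (d * c / (2 - r)) - r * (d * c / (2 - r));
        0, (2 - r) * p, r * (d * c / (2 - r)) - d] : Matrix (Fin 3) (Fin 3) ℝ).map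
      Complex.ofReal).charpoly.IsRoot μ → μ.re < 0) ↔
    p > 1 / (1 - r) * (1 / ((1 - c) / c + r / ((2 - r) * (1 - r)))
      - (1 - r * c / (2 - r)) * d) := by
  simp only [charpoly_root]
  have h2r : 0 < 2 - r := by linarith
  have h1r : 0 < 1 - r := by linarith
  have h1c : 0 < 1 - c := by linarith
  have hG : 0 < (1 - c) / c + r / ((2 - r) * (1 - r)) := by positivity
  have hβ : 0 < 1 - r * c / (2 - r) := by
    rw [sub_pos, div_lt_one h2r]; nlinarith
  have e2 : (1 - r) * p + d - r * (d * c / (2 - r)) = (1 - r) * p + (1 - r * c / (2 - r)) * d := by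
    field_simp; ring
  have e1 : (1 - r) * p * (d - r * (d * c / (2 - r)))
      + (2 - r) * p * (r * (d * c / (2 - r)) - (1 - r) * (d * c / (2 - r)))
      = ((1 - r) * p * d * c) * ((1 - c) / c + r / ((2 - r) * (1 - r))) := by
    field_simp; ring
  have e0 : (1 - r) * (d * c / (2 - r)) * ((2 - r) * p) = (1 - r) * p * d * c := by
    field_simp
  rw [e2, e1, e0]
  generalize (1 - c) / c + r / ((2 - r) * (1 - r)) = G at *
  generalize 1 - r * c / (2 - r) = b at *
  have hK : 0 < (1 - r) * p * d * c := by positivity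
  rw [routh_cubic _ _ _ (by positivity) (by positivity) hK]
  rw [gt_iff_lt, one_div_mul_eq_div, div_lt_iff₀ h1r, sub_lt_iff_lt_add, div_lt_iff₀ hG]
  rw [show ((1 - r) * p + b * d) * ((1 - r) * p * d * c * G)
    = ((1 - r) * p * d * c) * ((p * (1 - r) + b * d) * G) by ring, lt_mul_iff_one_lt_right hK]

lemma jac_eq (a1 a2 p2 d3 k x y z : ℝ) (ha : 1 / 2 < a1) (hr : a2 < a1)
    (hr0 : 0 < a2) (hs : 1 + k * z = 2 * a1)
    (hx : x = (1 - a2 / a1) * p2 * y) (hy : (2 - a2 / a1) * p2 * y = d3 * z) :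
    modelJacobian a1 a2 p2 d3 k x y z =
      !![0, 0, -((1 - a2 / a1) * (d3 * (1 - 1 / (2 * a1)) / (2 - a2 / a1)));
        1, -((1 - a2 / a1) * p2), (1 - a2 / a1) * (d3 * (1 - 1 / (2 * a1)) / (2 - a2 / a1))
          - (a2 / a1) * (d3 * (1 - 1 / (2 * a1)) / (2 - a2 / a1));
        0, (2 - a2 / a1) * p2, (a2 / a1) * (d3 * (1 - 1 / (2 * a1)) / (2 - a2 / a1)) - d3] := by
  have ha0 : 0 < a1 := by linarith
  have hr1 : a2 / a1 < 1 := (div_lt_one ha0).2 hr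
  have h2r : 2 - a2 / a1 ≠ 0 := by linarith
  have hw : d3 * (1 - 1 / (2 * a1)) / (2 - a2 / a1) = k * p2 * y / (2 * a1) := by
    rw [div_eq_iff h2r]
    have : 1 - 1 / (2 * a1) = k * z / (2 * a1) := by
      rw [← hs]; field_simp [show 1 + k * z ≠ 0 by linarith]; ring
    rw [this]
    linear_combination -(k / (2 * a1)) * hy
  rw [hw, hx, modelJacobian, hs]
  ext i j
  fin_cases i <;> fin_cases j <;> simp <;> field_simp <;> first | ring1 | (ring_nf; done) | (ring_nf; simp)

lemma steady_forms (a1 a2 p2 d3 k x y z : ℝ) (hp : 0 < p2) (hk : 0 < k) (ha2 : 0 < a2)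
    (ha1 : 0 < a1)
    (hx : 0 < x) (hy : 0 < y) (hz : 0 < z) (h : IsSteadyState a1 a2 p2 d3 k x y z) :
    1 / 2 < a1 ∧ a2 < a1 ∧ 1 + k * z = 2 * a1 ∧ x = (1 - a2 / a1) * p2 * y ∧
      (2 - a2 / a1) * p2 * y = d3 * z := by
  obtain ⟨h1, h2, h3⟩ := h
  have hkz : 0 < k * z := by positivity
  have hs : 1 + k * z = 2 * a1 := by
    rcases mul_eq_zero.mp h1 with h | h
    · have : 2 * a1 / (1 + k * z) = 1 := by linarith
      rw [div_eq_one_iff_eq (by linarith)] at this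
      exact this.symm
    · exact absurd h hx.ne'
  rw [hs] at h2 h3
  have e1 : 2 * a2 / (2 * a1) = a2 / a1 := by field_simp
  have e2 : a1 / (2 * a1) = 1 / 2 := by field_simp
  have e3 : a2 / (2 * a1) = a2 / a1 / 2 := by field_simp
  rw [e1, e2] at h2
  rw [e3] at h3
  have hx' : x = (1 - a2 / a1) * p2 * y := by linear_combination h2
  refine ⟨by linarith, ?_, hs, hx', by linear_combination h3⟩
  have hpy : 0 < p2 * y := by positivity
  have : a2 / a1 < 1 := by
    by_contra hc
    push Not at hc
    nlinarith
  exact (div_lt_one ha1).1 this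

/-- **Existence and linearized stability of the positive steady state**:
the model has a strictly positive steady state at which every complex
eigenvalue of the Jacobian has negative real part iff `a1 > 1/2`, `a2 < a1`
and `p2 > (1/(1 − a2/a1))·(1/γ(a1,a2) − β(a1,a2)·d3)`. -/
theorem stmt_14 (a1 a2 p2 d3 k : ℝ)
    (ha1 : a1 ∈ Set.Ioo (0 : ℝ) 1) (ha2 : a2 ∈ Set.Ioo (0 : ℝ) 1)
    (hp2 : 0 < p2) (hd3 : 0 < d3) (hk : 0 < k) :
    (∃ x y z : ℝ, 0 < x ∧ 0 < y ∧ 0 < z ∧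
        IsSteadyState a1 a2 p2 d3 k x y z ∧
        ∀ μ : ℂ, ((modelJacobian a1 a2 p2 d3 k x y z).map
          Complex.ofReal).charpoly.IsRoot μ → μ.re < 0) ↔
    (a1 > 1 / 2 ∧ a2 < a1 ∧
      p2 > 1 / (1 - a2 / a1)
        * (1 / ((1 / (2 * a1)) / (1 - 1 / (2 * a1))
            + (a2 / a1) / ((2 - a2 / a1) * (1 - a2 / a1)))
          - (1 - (a2 / a1) * (1 - 1 / (2 * a1)) / (2 - a2 / a1)) * d3)) := by
  obtain ⟨ha10, ha11⟩ := ha1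
  obtain ⟨ha20, ha21⟩ := ha2
  have key : ∀ (_ : 1 / 2 < a1) (_ : a2 < a1), _ := fun h h' =>
    stab_iff (a2 / a1) (1 - 1 / (2 * a1)) p2 d3 (by positivity) ((div_lt_one ha10).2 h')
      (by rw [sub_pos, div_lt_one (by positivity)]; linarith)
      (by have : 0 < 1 / (2 * a1) := by positivity
          linarith) hp2 hd3
  rw [sub_sub_cancel] at key
  constructor
  · rintro ⟨x, y, z, hx, hy, hz, hst, hroot⟩
    obtain ⟨h1, h2, hs, hx', hy'⟩ := steady_forms a1 a2 p2 d3 k x y z hp2 hk ha20 ha10 hx hy hz hst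
    rw [jac_eq a1 a2 p2 d3 k x y z h1 h2 ha20 hs hx' hy'] at hroot
    exact ⟨h1, h2, (key h1 h2).1 hroot⟩
  · rintro ⟨h1, h2, h3⟩
    have hr1 : a2 / a1 < 1 := (div_lt_one ha10).2 h2
    have h1r : 0 < 1 - a2 / a1 := by linarith
    have h2r : 0 < 2 - a2 / a1 := by linarith
    have hz : 0 < (2 * a1 - 1) / k := div_pos (by linarith) hk
    obtain ⟨z, hzd⟩ : ∃ z, z = (2 * a1 - 1) / k := ⟨_, rfl⟩
    rw [← hzd] at hz
    have hs : 1 + k * z = 2 * a1 := by rw [hzd]; field_simp; ring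
    obtain ⟨y, hyd⟩ : ∃ y, y = d3 * z / ((2 - a2 / a1) * p2) := ⟨_, rfl⟩
    have hy : 0 < y := by rw [hyd]; positivity
    have hy' : (2 - a2 / a1) * p2 * y = d3 * z := by
      rw [hyd]; exact mul_div_cancel₀ _ (by positivity)
    refine ⟨(1 - a2 / a1) * p2 * y, y, z, by positivity, hy, hz, ⟨?_, ?_, ?_⟩, ?_⟩
    · rw [hs, div_self (by positivity)]; ring
    · rw [hs]; field_simp; ring
    · rw [hs, ← hy']; field_simp; ring
    · rw [jac_eq a1 a2 p2 d3 k _ y z h1 h2 ha20 hs rfl hy']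
      exact (key h1 h2).2 h3
end

section
/- Let a1 ∈ (1/2, 1), a2 ∈ (0, a1), and 0 < d3 < 1/(β(a1,a2)·γ(a1,a2)), and set p2 = p2* := (1/(1 − a2/a1))·(1/γ(a1,a2) − β(a1,a2)·d3) (which is positive). Then the characteristic polynomial of the Jacobian J2 at the positive steady state E2 factors as (λ + 1/γ(a1,a2))·(λ² + ω²), where ω² = (1/γ(a1,a2) − β(a1,a2)·d3)·γ(a1,a2)·(1 − 1/(2a1))·d3 > 0; in particular J2 has exactly one negative real eigenvalue −1/γ(a1,a2) and a pair of nonzero purely imaginary eigenvalues ±i·ω. -/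
open Polynomial Matrix

theorem charpoly_aux (a b c d e u w : ℝ) (h1 : b - e = u) (h2 : -(b * e) - c * d = w)
    (h3 : a * d = u * w) :
    (!![0, 0, -a; 1, -b, c; 0, d, e] : Matrix (Fin 3) (Fin 3) ℝ).charpoly
      = (X + C u) * (X ^ 2 + C w) := by
  have h3' : (C a * C d : ℝ[X]) = C u * C w := by rw [← C_mul, ← C_mul, h3]
  have h2' : (-(C b * C e) - C c * C d : ℝ[X]) = C w := by
    rw [← C_mul, ← C_mul, ← C_neg, ← C_sub, h2]
  have h1' : (C b - C e : ℝ[X]) = C u := by rw [← C_sub, h1]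
  rw [Matrix.charpoly, Matrix.det_fin_three]
  simp
  linear_combination X ^ 2 * h1' + X * h2' + h3'

theorem alg_aux (r s d : ℝ) (hr0 : 0 < r) (hr1 : r < 1) (hs0 : 0 < s) (hs1 : s < 1)
    (hd : 0 < d)
    (beta gam p2 w2 : ℝ) (hb : beta = 1 - r * s / (2 - r))
    (hg : gam = (1 - s) / s + r / ((2 - r) * (1 - r)))
    (hdm : d < 1 / (beta * gam))
    (hp : p2 = 1 / (1 - r) * (1 / gam - beta * d))
    (hw : w2 = (1 / gam - beta * d) * gam * s * d) :
    0 < gam ∧ 0 < p2 ∧ 0 < w2 ∧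
    (1 - r) * p2 - (r * s / (2 - r) - 1) * d = 1 / gam ∧
    -((1 - r) * p2 * ((r * s / (2 - r) - 1) * d)) - s * (1 - 2 * r) * d / (2 - r) * ((2 - r) * p2)
      = w2 ∧
    s * (1 - r) * d / (2 - r) * ((2 - r) * p2) = 1 / gam * w2 := by
  have h2 : 0 < 2 - r := by linarith
  have h1 : 0 < 1 - r := by linarith
  have h1s : 0 < 1 - s := by linarith
  have hgam : 0 < gam := by rw [hg]; positivity
  have hbeta : 0 < beta := by
    rw [hb, sub_pos, div_lt_one h2]; nlinarith
  have hq : 0 < 1 / gam - beta * d := by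
    rw [lt_div_iff₀ (by positivity)] at hdm
    rw [sub_pos, lt_div_iff₀ hgam]; linarith
  have hp' : (1 - r) * p2 = 1 / gam - beta * d := by rw [hp]; field_simp
  have hb' : r * s / (2 - r) - 1 = - beta := by rw [hb]; ring
  have hg' : (1 - r) * s * gam = (1 - r) * (1 - s) + r * s / (2 - r) := by
    rw [hg]; field_simp
  refine ⟨hgam, by rw [hp]; positivity, by rw [hw]; positivity, ?_, ?_, ?_⟩
  · rw [hp', hb']; ring
  · rw [hw, ← hp', show (1 - r) * p2 * gam * s * d = p2 * d * ((1 - r) * s * gam) by ring, hg']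
    field_simp
    ring
  · rw [hw, ← hp']; field_simp

/-- **Purely imaginary eigenvalues at the Hopf bifurcation point**: for
`a1 ∈ (1/2,1)`, `a2 ∈ (0,a1)` and `0 < d3 < 1/(β·γ)`, at
`p2 = p2* = (1/(1 − a2/a1))·(1/γ − β·d3) > 0` the characteristic polynomial
of the Jacobian `J2` at `E2` factors as `(λ + 1/γ)(λ² + ω²)` with
`ω² = (1/γ − β·d3)·γ·(1 − 1/(2a1))·d3 > 0`; in particular `J2` has exactly
the eigenvalues `−1/γ < 0` and `±i·ω` with `ω ≠ 0`. -/
theorem stmt_17 (a1 a2 d3 : ℝ)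
    (ha1 : a1 ∈ Set.Ioo (1 / 2 : ℝ) 1) (ha2 : a2 ∈ Set.Ioo (0 : ℝ) a1)
    (hd3 : 0 < d3)
    (hd3max : d3 < 1 / ((1 - (a2 / a1) * (1 - 1 / (2 * a1)) / (2 - a2 / a1))
        * ((1 / (2 * a1)) / (1 - 1 / (2 * a1))
          + (a2 / a1) / ((2 - a2 / a1) * (1 - a2 / a1))))) :
    let beta : ℝ := 1 - (a2 / a1) * (1 - 1 / (2 * a1)) / (2 - a2 / a1)
    let gam : ℝ := (1 / (2 * a1)) / (1 - 1 / (2 * a1))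
        + (a2 / a1) / ((2 - a2 / a1) * (1 - a2 / a1))
    let p2 : ℝ := 1 / (1 - a2 / a1) * (1 / gam - beta * d3)
    let J2 : Matrix (Fin 3) (Fin 3) ℝ :=
      !![0, 0, -((1 - 1 / (2 * a1)) * (1 - a2 / a1) * d3 / (2 - a2 / a1));
         1, -((1 - a2 / a1) * p2),
           (1 - 1 / (2 * a1)) * (1 - 2 * (a2 / a1)) * d3 / (2 - a2 / a1);
         0, (2 - a2 / a1) * p2,
           ((a2 / a1) * (1 - 1 / (2 * a1)) / (2 - a2 / a1) - 1) * d3]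
    let w2 : ℝ := (1 / gam - beta * d3) * gam * (1 - 1 / (2 * a1)) * d3
    0 < p2 ∧ 0 < w2 ∧
    J2.charpoly = (X + C (1 / gam)) * (X ^ 2 + C w2) ∧
    (-(1 / gam) < (0 : ℝ)) ∧ Real.sqrt w2 ≠ 0 ∧
    (∀ μ : ℂ, (J2.map Complex.ofReal).charpoly.IsRoot μ ↔
      (μ = -((1 / gam : ℝ) : ℂ) ∨
       μ = Complex.I * (Real.sqrt w2 : ℝ) ∨
       μ = -(Complex.I * (Real.sqrt w2 : ℝ)))) := by
  intro beta gam p2 J2 w2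
  obtain ⟨h0, h1⟩ := ha1
  obtain ⟨h2, h3⟩ := ha2
  have ha : 0 < a1 := by linarith
  have hu : 1 / (2 * a1) < 1 := by rw [div_lt_one (by positivity)]; linarith
  have hu0 : 0 < 1 / (2 * a1) := by positivity
  obtain ⟨hgam, hp, hw, e1, e2, e3⟩ := alg_aux (a2 / a1) (1 - 1 / (2 * a1)) d3
    (by positivity) ((div_lt_one ha).2 h3) (by linarith) (by linarith) hd3
    beta gam p2 w2 rfl (by simp only [gam, sub_sub_cancel]) hd3max rfl rfl
  have hJ : J2.charpoly = (X + C (1 / gam)) * (X ^ 2 + C w2) :=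
    charpoly_aux _ _ _ _ _ _ _ e1 e2 e3
  have hs : ((Real.sqrt w2 : ℝ) : ℂ) ^ 2 = (w2 : ℂ) := by
    rw [← Complex.ofReal_pow, Real.sq_sqrt hw.le]
  refine ⟨hp, hw, hJ, by have := one_div_pos.2 hgam; linarith, (Real.sqrt_pos.2 hw).ne', ?_⟩
  intro μ
  have hm : (J2.map Complex.ofReal).charpoly = J2.charpoly.map Complex.ofRealHom :=
    Matrix.charpoly_map J2 Complex.ofRealHom
  rw [hm, hJ, Polynomial.IsRoot.def]
  simp only [Polynomial.map_mul, Polynomial.map_add, Polynomial.map_pow, Polynomial.map_X,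
    Polynomial.map_C, eval_mul, eval_add, eval_pow, eval_X, eval_C, Complex.ofRealHom_eq_coe]
  have hf : μ ^ 2 + (w2 : ℂ)
      = (μ - Complex.I * (Real.sqrt w2 : ℝ)) * (μ + Complex.I * (Real.sqrt w2 : ℝ)) := by
    rw [← hs]; linear_combination ((Real.sqrt w2 : ℂ) ^ 2) * Complex.I_sq
  rw [hf, mul_eq_zero, mul_eq_zero, add_eq_zero_iff_eq_neg, sub_eq_zero, add_eq_zero_iff_eq_neg]
end
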